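/- Let $A$ be a bialgebra and $\beta, \gamma : A \otimes A \to K$ convolution invertible linear maps such that the doubly-twisted multiplication $x \cdot y = \beta(x_{(1)}\otimes y_{(1)})\, x_{(2)}y_{(2)}\, \gamma(x_{(3)}\otimes y_{(3)})$ makes $A$ an associative unital algebra with unit $1_A$. Then $\beta$ is a unital 2-cocycle for $A$ if and only if $\gamma^{-1}$ is a unital 2-cocycle for $A$. -/

import Mathlib

open TensorProduct

variable {K A : Type*}

section Defs

variable [CommRing K] [Ring A] [Bialgebra K A]

/-- The comultiplication of the tensor product coalgebra `A ⊗ A`. -/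
noncomputable def comul2 : (A ⊗[K] A) →ₗ[K] (A ⊗[K] A) ⊗[K] (A ⊗[K] A) :=
  (TensorProduct.tensorTensorTensorComm K A A A A).toLinearMap ∘ₗ
    (TensorProduct.map Coalgebra.comul Coalgebra.comul)

/-- The counit of the tensor product coalgebra `A ⊗ A`. -/
noncomputable def counit2 : (A ⊗[K] A) →ₗ[K] K :=
  (TensorProduct.lid K K).toLinearMap ∘ₗ
    (TensorProduct.map Coalgebra.counit Coalgebra.counit)

/-- The comultiplication of the tensor product coalgebra `A ⊗ (A ⊗ A)`. -/
noncomputable def comul3 : (A ⊗[K] (A ⊗[K] A)) →ₗ[K]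
    (A ⊗[K] (A ⊗[K] A)) ⊗[K] (A ⊗[K] (A ⊗[K] A)) :=
  (TensorProduct.tensorTensorTensorComm K A A (A ⊗[K] A) (A ⊗[K] A)).toLinearMap ∘ₗ
    (TensorProduct.map Coalgebra.comul comul2)

/-- Convolution product on linear maps `A ⊗ A → K`. -/
noncomputable def conv2 (f g : (A ⊗[K] A) →ₗ[K] K) : (A ⊗[K] A) →ₗ[K] K :=
  (TensorProduct.lid K K).toLinearMap ∘ₗ (TensorProduct.map f g) ∘ₗ comul2

/-- Convolution product on linear maps `A ⊗ (A ⊗ A) → K`. -/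
noncomputable def conv3 (f g : (A ⊗[K] (A ⊗[K] A)) →ₗ[K] K) :
    (A ⊗[K] (A ⊗[K] A)) →ₗ[K] K :=
  (TensorProduct.lid K K).toLinearMap ∘ₗ (TensorProduct.map f g) ∘ₗ comul3

/-- Convolution product on linear maps `A ⊗ A → A`. -/
noncomputable def conv2A (f g : (A ⊗[K] A) →ₗ[K] A) : (A ⊗[K] A) →ₗ[K] A :=
  (LinearMap.mul' K A) ∘ₗ (TensorProduct.map f g) ∘ₗ comul2

/-- The 2-cocycle equation for `β`, relative to the multiplication of `A`:
`β(y₁ ⊗ z₁) β(x ⊗ y₂z₂) = β(x₁ ⊗ y₁) β(x₂y₂ ⊗ z)`, in convolution form. -/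
noncomputable def IsCocycleEq (β : (A ⊗[K] A) →ₗ[K] K) : Prop :=
  conv3 ((TensorProduct.lid K K).toLinearMap ∘ₗ TensorProduct.map Coalgebra.counit β)
      (β ∘ₗ TensorProduct.map LinearMap.id (LinearMap.mul' K A)) =
    conv3 (((TensorProduct.lid K K).toLinearMap ∘ₗ TensorProduct.map β Coalgebra.counit)
        ∘ₗ (TensorProduct.assoc K A A A).symm.toLinearMap)
      ((β ∘ₗ TensorProduct.map (LinearMap.mul' K A) LinearMap.id) ∘ₗ
        (TensorProduct.assoc K A A A).symm.toLinearMap)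

/-- The normalization condition `β(x ⊗ 1) = β(1 ⊗ x) = ε(x)`. -/
def IsUnital (β : (A ⊗[K] A) →ₗ[K] K) : Prop :=
  ∀ x : A, β (x ⊗ₜ[K] (1 : A)) = Coalgebra.counit (R := K) x ∧
    β ((1 : A) ⊗ₜ[K] x) = Coalgebra.counit (R := K) x

/-- The doubly twisted multiplication
`x · y = β(x₁ ⊗ y₁) x₂y₂ γ(x₃ ⊗ y₃)` of `{}_β A_γ`. -/
noncomputable def mulBetaGamma (β γ : (A ⊗[K] A) →ₗ[K] K) : (A ⊗[K] A) →ₗ[K] A :=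
  conv2A (conv2A ((Algebra.linearMap K A) ∘ₗ β) (LinearMap.mul' K A))
    ((Algebra.linearMap K A) ∘ₗ γ)

end Defs

section Convolution

open Coalgebra WithConv LinearMap

variable {R : Type*} [CommRing R]

/-- Precomposition with a coalgebra homomorphism, as a monoid homomorphism between the convolution
monoids of linear functionals. -/
noncomputable def convPullback {C D : Type*} [AddCommGroup C] [Module R C] [Coalgebra R C]
    [AddCommGroup D] [Module R D] [Coalgebra R D] (φ : C →ₗc[R] D) :
    WithConv (D →ₗ[R] R) →* WithConv (C →ₗ[R] R) where
  toFun f := toConv (f.ofConv ∘ₗ φ.toLinearMap)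
  map_one' := by
    ext x
    simp [LinearMap.convOne_def]
  map_mul' f g := by
    rw [convMul_comp_coalgHom_distrib]

/-- Convolution with a scalar-valued map on the left commutes with applying a functional. -/
lemma comp_algebraMap_convMul {E X : Type*} [AddCommGroup E] [Module R E] [Coalgebra R E]
    [Ring X] [Algebra R X] (δ : X →ₗ[R] R) (f : E →ₗ[R] R) (F : WithConv (E →ₗ[R] X)) :
    toConv (δ ∘ₗ (toConv (Algebra.linearMap R X ∘ₗ f) * F).ofConv) =
      toConv f * toConv (δ ∘ₗ F.ofConv) := by
  ext x
  have := (ℛ R x).convMul_apply (toConv (Algebra.linearMap R X ∘ₗ f)) F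
  have h := (ℛ R x).convMul_apply (toConv f) (toConv (δ ∘ₗ F.ofConv))
  refine Eq.trans (congrArg δ this) (Eq.trans ?_ h.symm)
  simp [← Algebra.smul_def]

/-- Convolution with a scalar-valued map on the right commutes with applying a functional. -/
lemma comp_convMul_algebraMap {E X : Type*} [AddCommGroup E] [Module R E] [Coalgebra R E]
    [Ring X] [Algebra R X] (δ : X →ₗ[R] R) (f : E →ₗ[R] R) (F : WithConv (E →ₗ[R] X)) :
    toConv (δ ∘ₗ (F * toConv (Algebra.linearMap R X ∘ₗ f)).ofConv) =
      toConv (δ ∘ₗ F.ofConv) * toConv f := by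
  ext x
  have := (ℛ R x).convMul_apply F (toConv (Algebra.linearMap R X ∘ₗ f))
  have h := (ℛ R x).convMul_apply (toConv (δ ∘ₗ F.ofConv)) (toConv f)
  refine Eq.trans (congrArg δ this) (Eq.trans ?_ h.symm)
  simp [← Algebra.commutes, ← Algebra.smul_def, mul_comm]

end Convolution

section Twist

open Coalgebra WithConv LinearMap

variable [CommRing K] [Ring A] [Bialgebra K A]

lemma comul2_eq_comul : (comul2 : A ⊗[K] A →ₗ[K] _) = comul := rfl

lemma comul3_eq_comul : (comul3 : A ⊗[K] (A ⊗[K] A) →ₗ[K] _) = comul := rfl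

lemma lid_eq_mul' : (TensorProduct.lid K K).toLinearMap = LinearMap.mul' K K := by
  ext; simp

lemma toConv_counit2 : toConv (counit2 : A ⊗[K] A →ₗ[K] K) = 1 := by
  ext; simp [counit2, LinearMap.convOne_def, mul_comm]

lemma toConv_conv2 (f g : A ⊗[K] A →ₗ[K] K) : toConv (conv2 f g) = toConv f * toConv g := by
  rw [conv2, lid_eq_mul', comul2_eq_comul]; rfl

lemma toConv_conv3 (f g : A ⊗[K] (A ⊗[K] A) →ₗ[K] K) :
    toConv (conv3 f g) = toConv f * toConv g := by
  rw [conv3, lid_eq_mul', comul3_eq_comul]; rfl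

lemma toConv_mulBetaGamma (β γ : A ⊗[K] A →ₗ[K] K) :
    toConv (mulBetaGamma β γ) = toConv (Algebra.linearMap K A ∘ₗ β) *
      toConv (LinearMap.mul' K A) * toConv (Algebra.linearMap K A ∘ₗ γ) := rfl

/-- `(x ⊗ y) ⊗ z ↦ ε(z) x ⊗ y`. -/
noncomputable def tensorCounitRight : (A ⊗[K] A) ⊗[K] A →ₗc[K] A ⊗[K] A :=
  (Coalgebra.TensorProduct.rid K K (A ⊗[K] A)).toCoalgHom.comp
    (Coalgebra.TensorProduct.map (CoalgHom.id K (A ⊗[K] A)) (Coalgebra.counitCoalgHom K A))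

/-- `x ⊗ (y ⊗ z) ↦ ε(x) y ⊗ z`. -/
noncomputable def tensorCounitLeft : A ⊗[K] (A ⊗[K] A) →ₗc[K] A ⊗[K] A :=
  (Coalgebra.TensorProduct.lid K (A ⊗[K] A)).toCoalgHom.comp
    (Coalgebra.TensorProduct.map (Coalgebra.counitCoalgHom K A) (CoalgHom.id K (A ⊗[K] A)))

/-- `(x ⊗ y) ⊗ z ↦ x y ⊗ z`. -/
noncomputable def mulTensorId : (A ⊗[K] A) ⊗[K] A →ₗc[K] A ⊗[K] A :=
  Coalgebra.TensorProduct.map (Bialgebra.mulCoalgHom K A) (CoalgHom.id K A)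

/-- `x ⊗ (y ⊗ z) ↦ x ⊗ y z`. -/
noncomputable def idTensorMul : A ⊗[K] (A ⊗[K] A) →ₗc[K] A ⊗[K] A :=
  Coalgebra.TensorProduct.map (CoalgHom.id K A) (Bialgebra.mulCoalgHom K A)

/-- The reassociation `x ⊗ (y ⊗ z) ↦ (x ⊗ y) ⊗ z`. -/
noncomputable def assocSymmHom : A ⊗[K] (A ⊗[K] A) →ₗc[K] (A ⊗[K] A) ⊗[K] A :=
  (Coalgebra.TensorProduct.assoc K K A A A).symm.toCoalgHom

/-- The inclusion `x ↦ x ⊗ 1`. -/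
noncomputable def tensorOneRight : A →ₗc[K] A ⊗[K] A where
  toLinearMap := (TensorProduct.mk K A A).flip 1
  counit_comp := by ext; simp
  map_comp_comul := by
    ext x
    simp only [LinearMap.comp_apply, LinearMap.flip_apply, TensorProduct.mk_apply,
      TensorProduct.comul_tmul, Bialgebra.comul_one]
    hopf_tensor_induction comul (R := K) x with x₁ x₂
    simp [Algebra.TensorProduct.one_def]

/-- The inclusion `x ↦ 1 ⊗ x`. -/
noncomputable def tensorOneLeft : A →ₗc[K] A ⊗[K] A where
  toLinearMap := TensorProduct.mk K A A 1
  counit_comp := by ext; simp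
  map_comp_comul := by
    ext x
    simp only [LinearMap.comp_apply, TensorProduct.mk_apply,
      TensorProduct.comul_tmul, Bialgebra.comul_one]
    hopf_tensor_induction comul (R := K) x with x₁ x₂
    simp [Algebra.TensorProduct.one_def]

lemma counit_comp_mulBetaGamma (β γ : A ⊗[K] A →ₗ[K] K) :
    toConv (counit ∘ₗ mulBetaGamma β γ) = toConv β * toConv γ := by
  have h := toConv_mulBetaGamma β γ
  rw [← ofConv_toConv (mulBetaGamma β γ), h, comp_convMul_algebraMap, comp_algebraMap_convMul]
  have hm : toConv (counit ∘ₗ LinearMap.mul' K A) = (1 : WithConv (A ⊗[K] A →ₗ[K] K)) := by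
    ext; simp [LinearMap.convOne_def, mul_comm]
  rw [hm, mul_one]

lemma isCocycleEq_iff (β : A ⊗[K] A →ₗ[K] K) : IsCocycleEq β ↔
    convPullback tensorCounitLeft (toConv β) * convPullback idTensorMul (toConv β) =
      convPullback assocSymmHom (convPullback tensorCounitRight (toConv β)) *
        convPullback assocSymmHom (convPullback mulTensorId (toConv β)) := by
  rw [IsCocycleEq, ← toConv_injective.eq_iff, toConv_conv3, toConv_conv3]
  have h₁ : toConv ((TensorProduct.lid K K).toLinearMap ∘ₗ TensorProduct.map counit β) =
      convPullback tensorCounitLeft (toConv β) := by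
    ext x y z
    simp [convPullback, tensorCounitLeft]
  have h₂ : toConv (((TensorProduct.lid K K).toLinearMap ∘ₗ TensorProduct.map β counit)
        ∘ₗ (TensorProduct.assoc K A A A).symm.toLinearMap) =
      convPullback assocSymmHom (convPullback tensorCounitRight (toConv β)) := by
    ext x y z
    simp [convPullback, tensorCounitRight, assocSymmHom, mul_comm]
  rw [h₁, h₂]
  rfl

lemma isUnital_iff (β : A ⊗[K] A →ₗ[K] K) : IsUnital β ↔
    convPullback tensorOneRight (toConv β) = 1 ∧ convPullback tensorOneLeft (toConv β) = 1 := by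
  simp only [IsUnital, forall_and]
  refine and_congr ⟨fun h => ?_, fun h x => ?_⟩ ⟨fun h => ?_, fun h x => ?_⟩
  · ext x; exact h x
  · exact LinearMap.congr_fun (congrArg ofConv h) x
  · ext x; exact h x
  · exact LinearMap.congr_fun (congrArg ofConv h) x

lemma map_algebraMap_comp_one (f : A ⊗[K] A →ₗ[K] K) :
    toConv (TensorProduct.map (Algebra.linearMap K A ∘ₗ f)
        (1 : WithConv (A →ₗ[K] A)).ofConv) =
      toConv (Algebra.linearMap K (A ⊗[K] A) ∘ₗ
        (convPullback tensorCounitRight (toConv f)).ofConv) := by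
  ext x y z
  simp [convPullback, tensorCounitRight, LinearMap.convOne_def, Algebra.algebraMap_eq_smul_one,
    Algebra.TensorProduct.one_def]
  rw [← TensorProduct.smul_tmul', smul_smul]

lemma map_mulBetaGamma_id (β γ : A ⊗[K] A →ₗ[K] K) :
    toConv (TensorProduct.map (mulBetaGamma β γ) LinearMap.id) =
      toConv (Algebra.linearMap K (A ⊗[K] A) ∘ₗ
          (convPullback tensorCounitRight (toConv β)).ofConv) *
        toConv (TensorProduct.map (LinearMap.mul' K A) (LinearMap.id : A →ₗ[K] A)) *
        toConv (Algebra.linearMap K (A ⊗[K] A) ∘ₗ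
          (convPullback tensorCounitRight (toConv γ)).ofConv) := by
  rw [← map_algebraMap_comp_one β, ← map_algebraMap_comp_one γ]
  have h₁ := TensorProduct.map_convMul_map (R := K)
    (f := toConv (Algebra.linearMap K A ∘ₗ β)) (h := toConv (LinearMap.mul' K A))
    (g := (1 : WithConv (A →ₗ[K] A))) (k := toConv LinearMap.id)
  have h₂ := TensorProduct.map_convMul_map (R := K)
    (f := toConv (Algebra.linearMap K A ∘ₗ β) * toConv (LinearMap.mul' K A))
    (h := toConv (Algebra.linearMap K A ∘ₗ γ))
    (g := (1 : WithConv (A →ₗ[K] A)) * toConv LinearMap.id) (k := 1)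
  rw [← h₁, one_mul, mul_one] at h₂
  exact h₂.symm

lemma comp_map_mulBetaGamma_id (δ β γ : A ⊗[K] A →ₗ[K] K) :
    toConv (δ ∘ₗ TensorProduct.map (mulBetaGamma β γ) LinearMap.id) =
      convPullback tensorCounitRight (toConv β) * convPullback mulTensorId (toConv δ) *
        convPullback tensorCounitRight (toConv γ) := by
  rw [← ofConv_toConv (TensorProduct.map (mulBetaGamma β γ) LinearMap.id), map_mulBetaGamma_id,
    comp_convMul_algebraMap, comp_algebraMap_convMul]
  rfl

lemma map_one_algebraMap_comp (f : A ⊗[K] A →ₗ[K] K) :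
    toConv (TensorProduct.map (1 : WithConv (A →ₗ[K] A)).ofConv
        (Algebra.linearMap K A ∘ₗ f)) =
      toConv (Algebra.linearMap K (A ⊗[K] A) ∘ₗ
        (convPullback tensorCounitLeft (toConv f)).ofConv) := by
  ext x y z
  simp [convPullback, tensorCounitLeft, LinearMap.convOne_def, Algebra.algebraMap_eq_smul_one,
    Algebra.TensorProduct.one_def]
  rw [← TensorProduct.smul_tmul', smul_smul, mul_comm]

lemma map_id_mulBetaGamma (β γ : A ⊗[K] A →ₗ[K] K) :
    toConv (TensorProduct.map LinearMap.id (mulBetaGamma β γ)) =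
      toConv (Algebra.linearMap K (A ⊗[K] A) ∘ₗ
          (convPullback tensorCounitLeft (toConv β)).ofConv) *
        toConv (TensorProduct.map (LinearMap.id : A →ₗ[K] A) (LinearMap.mul' K A)) *
        toConv (Algebra.linearMap K (A ⊗[K] A) ∘ₗ
          (convPullback tensorCounitLeft (toConv γ)).ofConv) := by
  rw [← map_one_algebraMap_comp β, ← map_one_algebraMap_comp γ]
  have h₁ := TensorProduct.map_convMul_map (R := K)
    (g := toConv (Algebra.linearMap K A ∘ₗ β)) (k := toConv (LinearMap.mul' K A))
    (f := (1 : WithConv (A →ₗ[K] A))) (h := toConv LinearMap.id)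
  have h₂ := TensorProduct.map_convMul_map (R := K)
    (g := toConv (Algebra.linearMap K A ∘ₗ β) * toConv (LinearMap.mul' K A))
    (k := toConv (Algebra.linearMap K A ∘ₗ γ))
    (f := (1 : WithConv (A →ₗ[K] A)) * toConv LinearMap.id) (h := 1)
  rw [← h₁, one_mul, mul_one] at h₂
  exact h₂.symm

lemma comp_map_id_mulBetaGamma (δ β γ : A ⊗[K] A →ₗ[K] K) :
    toConv (δ ∘ₗ TensorProduct.map LinearMap.id (mulBetaGamma β γ)) =
      convPullback tensorCounitLeft (toConv β) * convPullback idTensorMul (toConv δ) *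
        convPullback tensorCounitLeft (toConv γ) := by
  rw [← ofConv_toConv (TensorProduct.map LinearMap.id (mulBetaGamma β γ)),
    map_id_mulBetaGamma, comp_convMul_algebraMap, comp_algebraMap_convMul]
  rfl

/-- Applying the counit to associativity of the doubly twisted multiplication. -/
lemma convPullback_eq_of_assoc (β γ : A ⊗[K] A →ₗ[K] K)
    (hassoc : ∀ x y z : A,
      mulBetaGamma β γ (mulBetaGamma β γ (x ⊗ₜ[K] y) ⊗ₜ[K] z) =
        mulBetaGamma β γ (x ⊗ₜ[K] mulBetaGamma β γ (y ⊗ₜ[K] z))) :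
    convPullback assocSymmHom (convPullback tensorCounitRight (toConv β) *
        convPullback mulTensorId (toConv β * toConv γ) *
        convPullback tensorCounitRight (toConv γ)) =
      convPullback tensorCounitLeft (toConv β) *
        convPullback idTensorMul (toConv β * toConv γ) *
        convPullback tensorCounitLeft (toConv γ) := by
  rw [← counit_comp_mulBetaGamma, ← comp_map_mulBetaGamma_id, ← comp_map_id_mulBetaGamma]
  ext x y z
  exact congrArg counit (hassoc x y z)

end Twist

/-- if `β, γ : A ⊗ A → K` are convolution invertible and the doubly
twisted multiplication of `{}_β A_γ` is associative with unit `1_A`, then `β` is a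
unital 2-cocycle for `A` if and only if `γ⁻¹` is a unital 2-cocycle for `A`. -/
theorem beta_cocycle_iff_gammaInv_cocycle [CommRing K] [Ring A] [Bialgebra K A]
    (β γ βinv γinv : (A ⊗[K] A) →ₗ[K] K)
    (hβ₁ : conv2 β βinv = counit2) (hβ₂ : conv2 βinv β = counit2)
    (hγ₁ : conv2 γ γinv = counit2) (hγ₂ : conv2 γinv γ = counit2)
    (hassoc : ∀ x y z : A,
      mulBetaGamma β γ (mulBetaGamma β γ (x ⊗ₜ[K] y) ⊗ₜ[K] z) =
        mulBetaGamma β γ (x ⊗ₜ[K] mulBetaGamma β γ (y ⊗ₜ[K] z)))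
    (hone : ∀ x : A, mulBetaGamma β γ (x ⊗ₜ[K] (1 : A)) = x ∧
      mulBetaGamma β γ ((1 : A) ⊗ₜ[K] x) = x) :
    (IsCocycleEq β ∧ IsUnital β) ↔ (IsCocycleEq γinv ∧ IsUnital γinv) := by
  have unit_of (f g : A ⊗[K] A →ₗ[K] K) (h : conv2 f g = counit2) :
      WithConv.toConv f * WithConv.toConv g = 1 := by
    rw [← toConv_conv2, h, toConv_counit2]
  let b : (WithConv (A ⊗[K] A →ₗ[K] K))ˣ :=
    ⟨.toConv β, .toConv βinv, unit_of _ _ hβ₁, unit_of _ _ hβ₂⟩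
  let g : (WithConv (A ⊗[K] A →ₗ[K] K))ˣ :=
    ⟨.toConv γ, .toConv γinv, unit_of _ _ hγ₁, unit_of _ _ hγ₂⟩
  refine and_congr ?_ ?_
  · rw [isCocycleEq_iff, isCocycleEq_iff]
    have h := convPullback_eq_of_assoc β γ hassoc
    let p := Units.map (convPullback (tensorCounitLeft (K := K) (A := A)))
    let q := Units.map (convPullback (idTensorMul (K := K) (A := A)))
    let r := Units.map ((convPullback (assocSymmHom (K := K) (A := A))).comp
      (convPullback tensorCounitRight))
    let s := Units.map ((convPullback (assocSymmHom (K := K) (A := A))).comp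
      (convPullback mulTensorId))
    have hu : r b * s b * (s g * r g) = p b * q b * (q g * p g) := by
      rw [map_mul, map_mul, map_mul, map_mul] at h
      ext1
      simp only [Units.val_mul, mul_assoc]
      simp only [mul_assoc, map_mul] at h
      exact h
    have hb : p b * q b = r b * s b ↔ q g * p g = s g * r g := by
      constructor <;> intro e <;> rw [e] at hu
      · exact (mul_left_cancel hu).symm
      · exact (mul_right_cancel hu).symm
    have hg : q g * p g = s g * r g ↔ p g⁻¹ * q g⁻¹ = r g⁻¹ * s g⁻¹ := by
      rw [← inv_inj]
      simp only [mul_inv_rev, map_inv]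
    exact Units.ext_iff.symm.trans ((hb.trans hg).trans Units.ext_iff)
  · rw [isUnital_iff, isUnital_iff]
    have pullback_eq (i : A →ₗc[K] A ⊗[K] A) (hi : ∀ x, mulBetaGamma β γ (i x) = x) :
        convPullback i (.toConv β) = convPullback i (.toConv γinv) := by
      have h : convPullback i (.toConv β * .toConv γ) = 1 := by
        rw [← counit_comp_mulBetaGamma]
        ext x
        exact congrArg Coalgebra.counit (hi x)
      have hu : Units.map (convPullback i) (b * g) = 1 := Units.ext h
      rw [map_mul, mul_eq_one_iff_eq_inv, ← map_inv] at hu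
      exact congrArg Units.val hu
    rw [pullback_eq tensorOneRight fun x => (hone x).1,
      pullback_eq tensorOneLeft fun x => (hone x).2]
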